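/- arXiv:2512.22459 — 6 statements merged into one kernel-verified Lean document; each statement's English description precedes it below -/
import Mathlib

section
/- Let G be a finite group acting transitively on a finite set Ω with nontrivial point stabilizers G_α, and let T be a subgroup of G; write T_ω = T ∩ G_ω. For α ∈ Ω set Γ^T(α) = {β ∈ Ω : T_α ∩ T_β = 1}, Γ_nr^T(α) = Ω \ ({α} ∪ Γ^T(α)), and n'(α) = |{γ ∈ Γ^T(α) : γ is fixed by some element h ∈ G_α with h ∉ T}|. If |Γ_nr^T(α) ∩ Γ_nr^T(α')| + 2·|Γ^T(α)| > |Ω| + 2·n'(α) holds for all α, α' ∈ Ω, then for all α, α' ∈ Ω there exists β ∈ Ω with G_α ∩ G_β = 1 and G_{α'} ∩ G_β = 1. -/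
open MulAction

/-- `Γ^T(α) = {β ∈ Ω : T_α ∩ T_β = 1}`, where `T_ω = T ∩ G_ω`. -/
def saxlNbhdT (G : Type*) {Ω : Type*} [Group G] [MulAction G Ω] (T : Subgroup G) (α : Ω) :
    Set Ω :=
  {β | (T ⊓ stabilizer G α) ⊓ (T ⊓ stabilizer G β) = ⊥}

/-- `Γ_nr^T(α) = Ω \ ({α} ∪ Γ^T(α))`. -/
def saxlNonregT (G : Type*) {Ω : Type*} [Group G] [MulAction G Ω] (T : Subgroup G) (α : Ω) :
    Set Ω :=
  {β | β ≠ α ∧ β ∉ saxlNbhdT G T α}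

/-- `n'(α)`: the number of `γ ∈ Γ^T(α)` fixed by some `h ∈ G_α` with `h ∉ T`. -/
noncomputable def saxlNPrime (G : Type*) {Ω : Type*} [Group G] [MulAction G Ω] (T : Subgroup G)
    (α : Ω) : ℕ :=
  {γ ∈ saxlNbhdT G T α | ∃ h : G, h ∈ stabilizer G α ∧ h ∉ T ∧ h • γ = γ}.ncard

/-- A `T`-neighbour of `α` fixed by no element of `G_α` outside `T` is a neighbour of `α`. -/
theorem stabilizer_inf_stabilizer_eq_bot_of_mem_saxlNbhdT {G Ω : Type*} [Group G] [MulAction G Ω]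
    {T : Subgroup G} {α β : Ω} (hβ : β ∈ saxlNbhdT G T α)
    (hT : ∀ h ∈ stabilizer G α, h • β = β → h ∈ T) :
    stabilizer G α ⊓ stabilizer G β = ⊥ := by
  rw [eq_bot_iff]
  rintro h ⟨hα, hhβ⟩
  have hhT : h ∈ T := hT h hα hhβ
  have hmem : h ∈ (T ⊓ stabilizer G α) ⊓ (T ⊓ stabilizer G β) := ⟨⟨hhT, hα⟩, hhT, hhβ⟩
  rwa [show (T ⊓ stabilizer G α) ⊓ (T ⊓ stabilizer G β) = ⊥ from hβ] at hmem

/-- At least `|Γ^T(α)| - n'(α)` of the `T`-neighbours of `α` are neighbours of `α`. -/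
theorem ncard_saxlNbhdT_le (G : Type*) {Ω : Type*} [Group G] [MulAction G Ω] [Finite Ω]
    (T : Subgroup G) (α : Ω) :
    (saxlNbhdT G T α).ncard ≤ saxlNPrime G T α +
      {β ∈ saxlNbhdT G T α | stabilizer G α ⊓ stabilizer G β = ⊥}.ncard := by
  refine (Set.ncard_le_ncard ?_ (Set.toFinite _)).trans (Set.ncard_union_le _ _)
  intro β hβ
  by_cases h : ∃ h : G, h ∈ stabilizer G α ∧ h ∉ T ∧ h • β = β
  · exact Or.inl ⟨hβ, h⟩
  · refine Or.inr ⟨hβ, stabilizer_inf_stabilizer_eq_bot_of_mem_saxlNbhdT hβ ?_⟩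
    intro g hg hgβ
    by_contra hgT
    exact h ⟨g, hg, hgT, hgβ⟩

/-- **Statement 3.** Let `G` act transitively on a finite set `Ω` with nontrivial point
stabilizers, and let `T ≤ G`.  If
`|Γ_nr^T(α) ∩ Γ_nr^T(α')| + 2|Γ^T(α)| > |Ω| + 2 n'(α)` for all `α, α'`, then any two points
`α, α'` have a common neighbour `β` with `G_α ∩ G_β = 1` and `G_{α'} ∩ G_β = 1`. -/
theorem stmt_3 (G Ω : Type*) [Group G] [Finite G] [MulAction G Ω] [Finite Ω] [Nonempty Ω]
    (htrans : IsPretransitive G Ω)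
    (hstab : ∀ α : Ω, stabilizer G α ≠ ⊥)
    (T : Subgroup G)
    (hcond : ∀ α α' : Ω,
      Nat.card Ω + 2 * saxlNPrime G T α
        < (saxlNonregT G T α ∩ saxlNonregT G T α').ncard + 2 * (saxlNbhdT G T α).ncard) :
    ∀ α α' : Ω, ∃ β : Ω,
      stabilizer G α ⊓ stabilizer G β = ⊥ ∧ stabilizer G α' ⊓ stabilizer G β = ⊥ := by
  intro α α'
  by_contra! hne
  let A : Ω → Set Ω := fun ω ↦ {β ∈ saxlNbhdT G T ω | stabilizer G ω ⊓ stabilizer G β = ⊥}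
  let N : Set Ω := saxlNonregT G T α ∩ saxlNonregT G T α'
  have hA : Disjoint (A α) (A α') :=
    Set.disjoint_left.2 fun β h h' ↦ hne β h.2 h'.2
  have hN : Disjoint N (A α ∪ A α') := by
    refine Set.disjoint_left.2 ?_
    rintro β ⟨h, h'⟩ (hβ | hβ)
    · exact h.2 hβ.1
    · exact h'.2 hβ.1
  have hcard : N.ncard + ((A α).ncard + (A α').ncard) ≤ Nat.card Ω := by
    rw [← Set.ncard_union_eq hA, ← Set.ncard_union_eq hN]
    exact Set.ncard_le_card _
  have h₁ := hcond α α'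
  have h₂ := hcond α' α
  rw [Set.inter_comm] at h₂
  have h₃ : _ ≤ _ + (A α).ncard := ncard_saxlNbhdT_le G T α
  have h₄ : _ ≤ _ + (A α').ncard := ncard_saxlNbhdT_le G T α'
  change _ < N.ncard + _ at h₁ h₂
  omega
end

section
/- Let α ∈ K \ F and set y = e₂ + α·e₁ (a nonisotropic vector, since B(y,y) = 1). Then {K·τ_y(v) : v ∈ F³, v ≠ 0} ∩ w₀ = {K·e₁}; that is, the image of the standard Baer subplane under τ_y meets w₀ exactly in the isotropic point K·e₁. -/
noncomputable section

/-- The Hermitian form `B(x,y) = x₁σ(y₃) + x₂σ(y₂) + x₃σ(y₁)` on `V = K³` (anti-diagonal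
Gram matrix), where `σ(x) = x^q`. -/
def BformA (K : Type) [Field K] (q : ℕ) (x y : Fin 3 → K) : K :=
  x 0 * y 2 ^ q + x 1 * y 1 ^ q + x 2 * y 0 ^ q

/-- The reflection `τ_y(x) = -x + 2·(B(x,y)/B(y,y))·y`. -/
def tauReflA (K : Type) [Field K] (q : ℕ) (y x : Fin 3 → K) : Fin 3 → K :=
  -x + (2 * (BformA K q x y / BformA K q y y)) • y

/-- The image `{K·τ_y(v) : v ∈ F³, v ≠ 0}` of the standard Baer subplane under `τ_y`. -/
def tauPlane (K : Type) [Field K] (q : ℕ) (y : Fin 3 → K) :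
    Set (Submodule K (Fin 3 → K)) :=
  {W | ∃ v : Fin 3 → K, v ≠ 0 ∧ (∀ i, v i ^ q = v i) ∧
    W = Submodule.span K {tauReflA K q y v}}

/-- The standard Baer subplane `w₀ = {K·v : v ∈ F³, v ≠ 0}`. -/
def baerPlane (K : Type) [Field K] (q : ℕ) : Set (Submodule K (Fin 3 → K)) :=
  {W | ∃ v : Fin 3 → K, v ≠ 0 ∧ (∀ i, v i ^ q = v i) ∧ W = Submodule.span K {v}}

/-- In a finite field with `q ^ 2` elements, `q` a power of the prime `p`, the map `x ↦ x ^ q`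
is a ring endomorphism. -/
theorem exists_ringHom_pow {p m q : ℕ} (hp : p.Prime) (hq : q = p ^ m) {K : Type*} [Field K]
    [Fintype K] (hK : Fintype.card K = q ^ 2) : ∃ f : K →+* K, ∀ x, f x = x ^ q := by
  obtain ⟨r, hr⟩ := CharP.exists K
  obtain ⟨n, hrp, hn⟩ := FiniteField.card K r
  have hdvd : r ∣ (p ^ m) ^ 2 := by
    rw [← hq, ← hK, hn]
    exact dvd_pow_self r n.ne_zero
  obtain rfl : r = p :=
    (Nat.prime_dvd_prime_iff_eq hrp hp).1 (hrp.dvd_of_dvd_pow (hrp.dvd_of_dvd_pow hdvd))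
  have : ExpChar K r := ExpChar.prime hrp
  exact ⟨iterateFrobenius K r m, fun x => by rw [iterateFrobenius_def, hq]⟩

/-- In a finite field of odd order, `2 ≠ 0`. -/
theorem two_ne_zero_of_odd_card {K : Type*} [Field K] [Fintype K]
    (hK : Odd (Fintype.card K)) : (2 : K) ≠ 0 := by
  refine Ring.two_ne_zero fun h => ?_
  have := FiniteField.even_card_of_char_two h
  exact absurd (Nat.odd_iff.1 hK) (by omega)

/-- The explicit form of the reflection in `α e₁ + e₂`. -/
theorem tauReflA_apply {K : Type} [Field K] {q : ℕ} (hq : q ≠ 0) (α : K) (v : Fin 3 → K) :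
    tauReflA K q ![α, 1, 0] v =
      ![-v 0 + 2 * (v 1 + v 2 * α ^ q) * α, v 1 + 2 * (v 2 * α ^ q), -v 2] := by
  funext i
  fin_cases i <;> simp [tauReflA, BformA, hq]
  ring

/-- If `c * u` is nonzero and both `u` and `c * u` are fixed by `f`, then so is `c`. -/
theorem map_eq_self_of_mul_eq {K : Type*} [Field K] (f : K →+* K) {c u w : K} (hu : f u = u)
    (hw : f w = w) (hw0 : w ≠ 0) (h : c * u = w) : f c = c := by
  have hu0 : u ≠ 0 := by
    rintro rfl
    exact hw0 (by rw [← h, mul_zero])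
  rw [eq_div_of_mul_eq hu0 h, map_div₀, hu, hw]

/-- **Statement 8.** For `α ∈ K \ F` and `y = e₂ + α·e₁`, the image of the standard Baer
subplane under `τ_y` meets `w₀` exactly in the isotropic point `K·e₁`. -/
theorem stmt_8 (p m q : ℕ) (hp : p.Prime) (hpodd : Odd p) (hq : q = p ^ m) (hq7 : 7 ≤ q)
    (K : Type) [Field K] [Fintype K] (hK : Fintype.card K = q ^ 2)
    (α : K) (hα : α ^ q ≠ α) :
    tauPlane K q ![α, 1, 0] ∩ baerPlane K q
      = {Submodule.span K {![(1 : K), 0, 0]}} := by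
  have hq0 : q ≠ 0 := by omega
  obtain ⟨f, hf⟩ := exists_ringHom_pow hp hq hK
  have h2 : (2 : K) ≠ 0 := two_ne_zero_of_odd_card (by rw [hK, hq]; exact hpodd.pow.pow)
  have hα' : f α ≠ α := by rwa [hf]
  have hff : f (f α) = α := by
    rw [hf, hf, ← pow_mul, ← sq, ← hK, FiniteField.pow_card]
  apply Set.eq_singleton_iff_unique_mem.2
  constructor
  · have he : (![1, 0, 0] : Fin 3 → K) ≠ 0 := fun h => one_ne_zero (congrFun h 0)
    have hfix : ∀ i, (![1, 0, 0] : Fin 3 → K) i ^ q = (![1, 0, 0] : Fin 3 → K) i := by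
      intro i
      fin_cases i <;> simp [hq0]
    refine ⟨⟨_, he, hfix, ?_⟩, ⟨_, he, hfix, rfl⟩⟩
    have hτ : tauReflA K q ![α, 1, 0] ![1, 0, 0] = (-1 : K) • ![1, 0, 0] := by
      simp [tauReflA_apply hq0]
    rw [hτ, Submodule.span_singleton_smul_eq isUnit_one.neg]
  · rintro W ⟨⟨v, hv, hvF, rfl⟩, ⟨u, -, huF, hW⟩⟩
    simp only [← hf] at hvF huF
    have hmem : tauReflA K q ![α, 1, 0] v ∈ Submodule.span K {u} :=
      hW ▸ Submodule.mem_span_singleton_self _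
    obtain ⟨c, hc⟩ := Submodule.mem_span_singleton.1 hmem
    rw [tauReflA_apply hq0, ← hf] at hc
    have hc0 : c * u 0 = -v 0 + 2 * (v 1 + v 2 * f α) * α := congrFun hc 0
    have hc1 : c * u 1 = v 1 + 2 * (v 2 * f α) := congrFun hc 1
    have hc2 : c * u 2 = -v 2 := congrFun hc 2
    have hv2 : v 2 = 0 := by
      by_contra h
      have hcF : f c = c :=
        map_eq_self_of_mul_eq f (huF 2) (by rw [map_neg, hvF]) (neg_ne_zero.2 h) hc2
      have key := congrArg f hc1
      simp only [map_add, map_mul, map_ofNat, hcF, huF, hvF, hff] at key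
      have : 2 * v 2 * (f α - α) = 0 := by linear_combination key - hc1
      exact mul_ne_zero (mul_ne_zero h2 h) (sub_ne_zero.2 hα') this
    have hv1 : v 1 = 0 := by
      by_contra h
      rw [hv2] at hc0 hc1
      have hcF : f c = c :=
        map_eq_self_of_mul_eq f (huF 1) (hvF 1) h (by rw [hc1]; ring)
      have key := congrArg f hc0
      simp only [map_add, map_neg, map_mul, map_ofNat, map_zero, hcF, huF, hvF] at key
      have : 2 * v 1 * (f α - α) = 0 := by linear_combination hc0 - key
      exact mul_ne_zero (mul_ne_zero h2 h) (sub_ne_zero.2 hα') this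
    have hv0 : v 0 ≠ 0 := by
      intro h
      apply hv
      funext i
      fin_cases i <;> assumption
    have hτ : tauReflA K q ![α, 1, 0] v = (-v 0) • ![(1 : K), 0, 0] := by
      simp [tauReflA_apply hq0, hv1, hv2]
    rw [hτ]
    exact Submodule.span_singleton_smul_eq (neg_ne_zero.2 hv0).isUnit _
end
end

section
/- Let α, β ∈ K \ F with α ≠ β, set y = e₂ + α·e₁ and z = e₂ + β·e₁, and let Δ = {K·τ_y(v) : v ∈ F³, v ≠ 0} ∩ {K·τ_z(v) : v ∈ F³, v ≠ 0}. Then every one-dimensional subspace in Δ is contained in the K-span of e₁ and e₂ (equivalently, is orthogonal to e₁ with respect to B); moreover |Δ| = q + 1 if α − β ∈ F, and |Δ| = 1 if α − β ∉ F. -/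
noncomputable section

theorem tauReflA_vec {K : Type} [Field K] {q : ℕ} (hq : q ≠ 0) (α : K) (v : Fin 3 → K) :
    tauReflA K q ![α, 1, 0] v =
      ![-v 0 + 2 * α * (v 1 + α ^ q * v 2), v 1 + 2 * α ^ q * v 2, -v 2] := by
  ext i
  fin_cases i <;> simp [tauReflA, BformA, hq] <;> ring

theorem span_mem_tauPlane {K : Type} [Field K] {q : ℕ} (hq : q ≠ 0) (α a b : K)
    (ha : (-a) ^ q = -a) (hb : b ^ q = b) (hab : a ≠ 0 ∨ b ≠ 0) :
    Submodule.span K {![a + 2 * α * b, b, 0]} ∈ tauPlane K q ![α, 1, 0] := by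
  refine ⟨![-a, b, 0], fun h => ?_, fun i => ?_, ?_⟩
  · have h0 := congrFun h 0
    have h1 := congrFun h 1
    simp at h0 h1
    tauto
  · fin_cases i <;> simp [ha, hb, hq]
  · rw [tauReflA_vec hq]
    simp

/-- If the images of two `σ`-fixed vectors under the two reflections are proportional, then both
vectors are orthogonal to `e₁`, and either `α - β` is fixed or both are multiples of `e₁`. -/
theorem fixed_of_smul_tauReflA_eq {K : Type} [Field K] {q : ℕ} (hq : q ≠ 0) (h2 : (2 : K) ≠ 0)
    (σ : K →+* K) (hσ : ∀ x, σ x = x ^ q) (hσσ : ∀ x, σ (σ x) = x)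
    {α β c : K} (hα : σ α ≠ α) (hαβ : α ≠ β) (hc : c ≠ 0) {u v : Fin 3 → K}
    (hu : ∀ i, σ (u i) = u i) (hv : ∀ i, σ (v i) = v i)
    (h : c • tauReflA K q ![α, 1, 0] u = tauReflA K q ![β, 1, 0] v) :
    u 2 = 0 ∧ (σ (α - β) = α - β ∨ u 1 = 0) := by
  rw [tauReflA_vec hq, tauReflA_vec hq, ← hσ, ← hσ] at h
  have e0 : c * (-u 0 + 2 * α * (u 1 + σ α * u 2)) = -v 0 + 2 * β * (v 1 + σ β * v 2) := by
    simpa using congrFun h 0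
  have e1 : c * (u 1 + 2 * σ α * u 2) = v 1 + 2 * σ β * v 2 := by simpa using congrFun h 1
  have e2 : v 2 = c * u 2 := by simpa using (congrFun h 2).symm
  have fixed_of_mul : ∀ i j, u i ≠ 0 → v j = c * u i → σ c = c := by
    intro i j hi hj
    have hs := congrArg σ hj
    rw [map_mul, hu, hv, hj] at hs
    exact (mul_right_cancel₀ hi hs).symm
  have hu2 : u 2 = 0 := by
    by_contra hne
    have hcσ := fixed_of_mul 2 2 hne e2
    have s0 := congrArg σ e0
    have s1 := congrArg σ e1
    simp only [map_mul, map_add, map_neg, map_ofNat, hσσ, hu, hv, hcσ] at s0 s1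
    rw [e2] at e0 e1 s0 s1
    have hdiff : α - σ α = β - σ β := by
      apply mul_left_cancel₀ (mul_ne_zero h2 (mul_ne_zero hc hne))
      linear_combination s1 - e1
    have hα' : α - σ α ≠ 0 := sub_ne_zero.2 hα.symm
    have hv1 : c * u 1 = v 1 := by
      apply mul_left_cancel₀ (mul_ne_zero h2 hα')
      linear_combination e0 - s0 - 2 * v 1 * hdiff
    have hzero : (2 * (c * u 2)) * (α - β) = 0 := by
      linear_combination s1 - hv1
    exact mul_ne_zero (mul_ne_zero h2 (mul_ne_zero hc hne)) (sub_ne_zero.2 hαβ) hzero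
  refine ⟨hu2, or_iff_not_imp_right.2 fun hne => ?_⟩
  rw [hu2, mul_zero] at e2
  simp only [hu2, e2, mul_zero, add_zero] at e0 e1
  have hcσ := fixed_of_mul 1 1 hne e1.symm
  have hdiff : 2 * (c * u 1) * (α - β) = c * u 0 - v 0 := by
    linear_combination e0 - 2 * β * e1
  have s := congrArg σ hdiff
  rw [map_mul, map_mul, map_mul, map_sub σ (c * u 0), map_mul, map_ofNat, hcσ, hu, hu, hv,
    ← hdiff] at s
  exact mul_left_cancel₀ (mul_ne_zero h2 (mul_ne_zero hc hne)) s

theorem exists_unit_smul_of_mem_inter {K : Type} [Field K] {q : ℕ} {y z : Fin 3 → K}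
    {W : Submodule K (Fin 3 → K)} (hW : W ∈ tauPlane K q y ∩ tauPlane K q z) :
    ∃ u v : Fin 3 → K, u ≠ 0 ∧ (∀ i, u i ^ q = u i) ∧ (∀ i, v i ^ q = v i) ∧
      W = Submodule.span K {tauReflA K q y u} ∧
      ∃ c : K, c ≠ 0 ∧ c • tauReflA K q y u = tauReflA K q z v := by
  obtain ⟨⟨u, hu0, hu, rfl⟩, v, -, hv, h⟩ := hW
  obtain ⟨c, hc⟩ := Submodule.span_singleton_eq_span_singleton.1 h
  exact ⟨u, v, hu0, hu, hv, rfl, c, c.ne_zero, hc⟩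

open Polynomial in
/-- A field with `q ^ 2` elements has exactly `q` solutions of `x ^ q = x`. -/
theorem ncard_pow_eq_self {K : Type} [Field K] [Fintype K] {q : ℕ} (hq : 1 < q)
    (hK : Fintype.card K = q ^ 2) : {x : K | x ^ q = x}.ncard = q := by
  classical
  set P : K[X] := X ^ q - X with hP
  have hP0 : P ≠ 0 := FiniteField.X_pow_card_sub_X_ne_zero K hq
  have hQ0 : (X ^ Fintype.card K - X : K[X]) ≠ 0 :=
    FiniteField.X_pow_card_sub_X_ne_zero K Fintype.one_lt_card
  have hdvd : P ∣ X ^ Fintype.card K - X := by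
    have h := (sub_dvd_pow_sub_pow (X ^ q : K[X]) X q).add (dvd_refl P)
    rwa [← pow_mul, ← sq, ← hK, hP, sub_add_sub_cancel] at h
  have hnodup : P.roots.Nodup := by
    refine Multiset.nodup_of_le (roots.le_of_dvd hQ0 hdvd) ?_
    rw [FiniteField.roots_X_pow_card_sub_X]
    exact Finset.univ.nodup
  have hsplits : P.Splits := Splits.of_dvd
    (by simpa using (FiniteField.isSplittingField_sub K K).splits) hQ0 hdvd
  have hset : {x : K | x ^ q = x} = (P.roots.toFinset : Set K) := by
    ext x
    rw [Finset.mem_coe, Multiset.mem_toFinset, mem_roots hP0]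
    simp [hP, sub_eq_zero]
  rw [hset, Set.ncard_coe_finset, Multiset.toFinset_card_of_nodup hnodup,
    ← hsplits.natDegree_eq_card_roots]
  exact FiniteField.X_pow_card_sub_X_natDegree_eq K hq

/-- **Statement 9.** Let `α, β ∈ K \ F` with `α ≠ β`, `y = e₂ + α·e₁`, `z = e₂ + β·e₁` and
`Δ = τ_y(w₀) ∩ τ_z(w₀)`.  Every line in `Δ` lies in the `K`-span of `e₁, e₂`; moreover
`|Δ| = q + 1` if `α − β ∈ F` and `|Δ| = 1` if `α − β ∉ F`. -/
theorem stmt_9 (p m q : ℕ) (hp : p.Prime) (hpodd : Odd p) (hq : q = p ^ m) (hq7 : 7 ≤ q)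
    (K : Type) [Field K] [Fintype K] (hK : Fintype.card K = q ^ 2)
    (α β : K) (hα : α ^ q ≠ α) (hβ : β ^ q ≠ β) (hαβ : α ≠ β) :
    (∀ W ∈ tauPlane K q ![α, 1, 0] ∩ tauPlane K q ![β, 1, 0],
      W ≤ Submodule.span K {![(1 : K), 0, 0], ![(0 : K), 1, 0]}) ∧
    ((α - β) ^ q = α - β →
      (tauPlane K q ![α, 1, 0] ∩ tauPlane K q ![β, 1, 0]).ncard = q + 1) ∧
    ((α - β) ^ q ≠ α - β →
      (tauPlane K q ![α, 1, 0] ∩ tauPlane K q ![β, 1, 0]).ncard = 1) := by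
  have hq0 : q ≠ 0 := by omega
  have : Fact p.Prime := ⟨hp⟩
  have : CharP K p := by
    rw [hq, ← pow_mul] at hK
    exact charP_of_card_eq_prime_pow hK
  have h2 : (2 : K) ≠ 0 := Ring.two_ne_zero (by
    rw [ringChar.eq K p]
    rintro rfl
    exact absurd hpodd (by decide))
  obtain ⟨σ, hσ⟩ : ∃ σ : K →+* K, ∀ x, σ x = x ^ q :=
    ⟨iterateFrobenius K p m, fun x => by rw [iterateFrobenius_def, hq]⟩
  have hσσ : ∀ x, σ (σ x) = x := fun x => by
    rw [hσ, hσ, ← pow_mul, ← sq, ← hK, FiniteField.pow_card]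
  have hneg : ∀ x : K, x ^ q = x → (-x) ^ q = -x := fun x hx => by
    rw [← hσ, map_neg, hσ, hx]
  have classify : ∀ W ∈ tauPlane K q ![α, 1, 0] ∩ tauPlane K q ![β, 1, 0],
      ∃ a b : K, a ^ q = a ∧ b ^ q = b ∧ (a ≠ 0 ∨ b ≠ 0) ∧
        W = Submodule.span K {![a + 2 * α * b, b, 0]} ∧ ((α - β) ^ q = α - β ∨ b = 0) := by
    intro W hW
    obtain ⟨u, v, hu0, hu, hv, rfl, c, hc, h⟩ := exists_unit_smul_of_mem_inter hW
    obtain ⟨hu2, hor⟩ := fixed_of_smul_tauReflA_eq hq0 h2 σ hσ hσσ (by rwa [hσ]) hαβ hc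
      (fun i => by rw [hσ, hu]) (fun i => by rw [hσ, hv]) h
    refine ⟨-u 0, u 1, hneg _ (hu 0), hu 1, ?_, ?_, by rwa [hσ] at hor⟩
    · contrapose! hu0
      ext i
      fin_cases i
      · simpa using hu0.1
      · exact hu0.2
      · exact hu2
    · rw [tauReflA_vec hq0, hu2]
      simp
  have mem_e₁ : Submodule.span K {![(1 : K), 0, 0]} ∈
      tauPlane K q ![α, 1, 0] ∩ tauPlane K q ![β, 1, 0] := by
    have h (γ : K) := span_mem_tauPlane hq0 γ 1 0 (hneg 1 (one_pow q)) (zero_pow hq0)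
      (Or.inl one_ne_zero)
    simp only [mul_zero, add_zero] at h
    exact ⟨h α, h β⟩
  have span_e₁ (a : K) (ha : a ≠ 0) :
      Submodule.span K {![a, 0, 0]} = Submodule.span K {![(1 : K), 0, 0]} := by
    refine (Submodule.span_singleton_eq_span_singleton.2 ⟨Units.mk0 a ha, ?_⟩).symm
    ext i
    fin_cases i <;> simp [Units.smul_def]
  refine ⟨fun W hW => ?_, fun hd => ?_, fun hd => ?_⟩
  · obtain ⟨a, b, -, -, -, rfl, -⟩ := classify W hW
    rw [Submodule.span_singleton_le_iff_mem, Submodule.mem_span_pair]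
    refine ⟨a + 2 * α * b, b, ?_⟩
    ext i
    fin_cases i <;> simp
  · set f : K → Submodule K (Fin 3 → K) := fun s => Submodule.span K {![s + 2 * α, 1, 0]} with hf
    have hΔ : tauPlane K q ![α, 1, 0] ∩ tauPlane K q ![β, 1, 0] =
        insert (Submodule.span K {![(1 : K), 0, 0]}) (f '' {x | x ^ q = x}) := by
      apply subset_antisymm
      · intro W hW
        obtain ⟨a, b, ha, hb, hab, rfl, -⟩ := classify W hW
        rcases eq_or_ne b 0 with rfl | hb0
        · left
          simpa using span_e₁ a (by simpa using hab)
        · refine Or.inr ⟨a / b, by simp [div_pow, ha, hb], ?_⟩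
          refine Submodule.span_singleton_eq_span_singleton.2 ⟨Units.mk0 b hb0, ?_⟩
          ext i
          fin_cases i <;> simp [Units.smul_def]
          field_simp
      · rintro W (rfl | ⟨s, hs, rfl⟩)
        · exact mem_e₁
        · have hs' : (s + 2 * (α - β)) ^ q = s + 2 * (α - β) := by
            rw [← hσ, map_add, map_mul, map_ofNat, hσ, hσ, hs, hd]
          have h₁ := span_mem_tauPlane hq0 α s 1 (hneg s hs) (one_pow q) (Or.inr one_ne_zero)
          have h₂ := span_mem_tauPlane hq0 β _ 1 (hneg _ hs') (one_pow q) (Or.inr one_ne_zero)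
          rw [mul_one] at h₁
          rw [show s + 2 * (α - β) + 2 * β * 1 = s + 2 * α by ring] at h₂
          exact ⟨h₁, h₂⟩
    have hinj : Function.Injective f := by
      intro s t hst
      obtain ⟨c, hc⟩ := Submodule.span_singleton_eq_span_singleton.1 hst
      have h0 := congrFun hc 0
      have h1 := congrFun hc 1
      simp [Units.smul_def] at h0 h1
      simpa [h1] using h0
    have hnot : Submodule.span K {![(1 : K), 0, 0]} ∉ f '' {x | x ^ q = x} := by
      rintro ⟨s, -, hs⟩
      obtain ⟨c, hc⟩ := Submodule.span_singleton_eq_span_singleton.1 hs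
      have h1 := congrFun hc 1
      simp [Units.smul_def] at h1
    rw [hΔ, Set.ncard_insert_of_notMem hnot (Set.toFinite _), Set.ncard_image_of_injective _ hinj,
      ncard_pow_eq_self (by omega) hK]
  · rw [Set.ncard_eq_one]
    refine ⟨_, subset_antisymm (fun W hW => ?_) (Set.singleton_subset_iff.2 mem_e₁)⟩
    obtain ⟨a, b, -, -, hab, rfl, hor⟩ := classify W hW
    obtain rfl := hor.resolve_left hd
    simpa using span_e₁ a (by simpa using hab)
end
end

section
/- Let β₁, β₂, β₃ ∈ V be such that B(β_i, β_j) ∈ F for all i, j and the 3×3 matrix (B(β_i, β_j))_{i,j} is invertible, and let W = {a₁β₁ + a₂β₂ + a₃β₃ : a₁, a₂, a₃ ∈ F} be their F-span. Then for every nonzero δ ∈ V: there exists a ∈ K \ {0} with a·δ ∈ W if and only if there exists a ∈ K \ {0} with B(a·δ, β_j) ∈ F for j = 1, 2, 3. -/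
noncomputable section

/-- The Hermitian form `B(x,y) = x₁σ(y₁) + x₂σ(y₂) + x₃σ(y₃)` on `V = K³`,
where `σ(x) = x^q`. -/
def Bform (K : Type) [Field K] (q : ℕ) (x y : Fin 3 → K) : K :=
  ∑ i, x i * y i ^ q

/-- The `F`-span `{a₁β₁ + a₂β₂ + a₃β₃ : aᵢ ∈ F}` of a triple of vectors,
where `F = {x : K | x^q = x}`. -/
def FSpan (K : Type) [Field K] (q : ℕ) (β : Fin 3 → Fin 3 → K) : Set (Fin 3 → K) :=
  {x | ∃ c : Fin 3 → K, (∀ i, c i ^ q = c i) ∧ x = ∑ i, c i • β i}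

open scoped Matrix

/-- A row vector is fixed by a ring endomorphism when its product with some invertible fixed
matrix is fixed. -/
theorem map_eq_self_of_vecMul_fixed {K n : Type*} [Field K] [Fintype n] [DecidableEq n]
    (φ : K →+* K) {G : Matrix n n K} (hG : G.map φ = G) (hdet : G.det ≠ 0) {c : n → K}
    (hc : ∀ j, φ ((c ᵥ* G) j) = (c ᵥ* G) j) (i : n) : φ (c i) = c i := by
  have hinj : Function.Injective fun v : n → K => v ᵥ* G :=
    Matrix.vecMul_injective_of_isUnit ((Matrix.isUnit_iff_isUnit_det G).2 hdet.isUnit)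
  have h : (φ ∘ c) ᵥ* G = c ᵥ* G := by
    funext j
    rw [← hc j, RingHom.map_vecMul, hG]
  exact congrFun (hinj h) i

/-- The form pairs with a triple of vectors through the conjugate transpose of their matrix. -/
theorem Bform_eq_vecMul (K : Type) [Field K] (q : ℕ) (x : Fin 3 → K) (β : Fin 3 → Fin 3 → K)
    (j : Fin 3) :
    Bform K q x (β j) = (x ᵥ* ((Matrix.of β).map (· ^ q))ᵀ) j := rfl

/-- **Statement 10.** Let `β₁, β₂, β₃` have Gram matrix with entries in `F` and invertible,
and `W` their `F`-span.  For every nonzero `δ ∈ V`: `a·δ ∈ W` for some `a ≠ 0` iff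
`B(a·δ, β_j) ∈ F` for `j = 1,2,3` for some `a ≠ 0`. -/
theorem stmt_10 (p m q : ℕ) (hp : p.Prime) (hpodd : Odd p) (hq : q = p ^ m) (hq7 : 7 ≤ q)
    (K : Type) [Field K] [Fintype K] (hK : Fintype.card K = q ^ 2)
    (β : Fin 3 → Fin 3 → K)
    (hGramF : ∀ i j, (Bform K q (β i) (β j)) ^ q = Bform K q (β i) (β j))
    (hGram : (Matrix.of fun i j => Bform K q (β i) (β j)).det ≠ 0) :
    ∀ δ : Fin 3 → K, δ ≠ 0 →
      ((∃ a : K, a ≠ 0 ∧ a • δ ∈ FSpan K q β) ↔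
        (∃ a : K, a ≠ 0 ∧ ∀ j : Fin 3,
          (Bform K q (a • δ) (β j)) ^ q = Bform K q (a • δ) (β j))) := by
  have : Fact p.Prime := ⟨hp⟩
  have : CharP K p := charP_of_card_eq_prime_pow (f := m * 2) (by rw [hK, hq, pow_mul])
  let φ : K →+* K := iterateFrobenius K p m
  have hφ : ∀ x, φ x = x ^ q := fun x => by rw [hq]; exact iterateFrobenius_def p m x
  set G : Matrix (Fin 3) (Fin 3) K := Matrix.of fun i j => Bform K q (β i) (β j)
  have hmul : Matrix.of β * ((Matrix.of β).map (· ^ q))ᵀ = G := rfl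
  have hGφ : G.map φ = G := by
    ext i j
    exact (hφ _).trans (hGramF i j)
  have hβ : (Matrix.of β).det ≠ 0 := by
    intro h
    rw [← hmul, Matrix.det_mul, h, zero_mul] at hGram
    exact hGram rfl
  have hcoord : ∀ c : Fin 3 → K, ∀ j,
      Bform K q (∑ i, c i • β i) (β j) = (c ᵥ* G) j := by
    intro c j
    rw [Bform_eq_vecMul, ← hmul, ← Matrix.vecMul_vecMul, Matrix.vecMul_eq_sum]
    rfl
  intro δ _
  refine exists_congr fun a => and_congr_right fun _ => ⟨?_, fun h => ?_⟩
  · rintro ⟨c, hc, hδ⟩ j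
    have hcφ : φ ∘ c = c := funext fun i => (hφ _).trans (hc i)
    rw [hδ, hcoord, ← hφ, RingHom.map_vecMul, hGφ, hcφ]
  · obtain ⟨c, hc⟩ := Matrix.vecMul_surjective_iff_isUnit.2
      ((Matrix.isUnit_iff_isUnit_det _).2 hβ.isUnit) (a • δ)
    have hδ : a • δ = ∑ i, c i • β i := by
      rw [← hc]
      exact Matrix.vecMul_eq_sum c (Matrix.of β)
    refine ⟨c, fun i => ?_, hδ⟩
    rw [← hφ]
    refine map_eq_self_of_vecMul_fixed φ hGφ hGram (fun j => ?_) i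
    rw [← hcoord, ← hδ, hφ, h j]
end
end

section
/- Let W₁ and W₂ each be the F-span of a triple of vectors of V whose Gram matrix with respect to B has all entries in F and is invertible, and write PG(W_i) = {K·v : v ∈ W_i, v ≠ 0}. If PG(W₁) ∩ PG(W₂) contains two distinct one-dimensional subspaces spanned by isotropic vectors, then PG(W₁) ∩ PG(W₂) also contains a one-dimensional subspace spanned by a nonisotropic vector. -/
noncomputable section

/-- `PG(W) = {K·v : v ∈ W, v ≠ 0}`. -/
def PGset (K : Type) [Field K] (W : Set (Fin 3 → K)) : Set (Submodule K (Fin 3 → K)) :=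
  {L | ∃ v ∈ W, v ≠ 0 ∧ L = Submodule.span K {v}}

theorem bform_smul_smul (K : Type) [Field K] (q : ℕ) (a b : K) (x y : Fin 3 → K) :
    Bform K q (a • x) (b • y) = a * b ^ q * Bform K q x y := by
  simp only [Bform, Pi.smul_apply, smul_eq_mul, Finset.mul_sum, mul_pow]
  exact Finset.sum_congr rfl fun i _ => by ring

theorem bform_add_left (K : Type) [Field K] (q : ℕ) (x y z : Fin 3 → K) :
    Bform K q (x + y) z = Bform K q x z + Bform K q y z := by
  simp only [Bform, Pi.add_apply, add_mul, Finset.sum_add_distrib]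

section Frobenius

variable {K : Type} [Field K] {q : ℕ} {σ : K →+* K}

theorem bform_add_right (hσ : ∀ x, σ x = x ^ q) (x y z : Fin 3 → K) :
    Bform K q x (y + z) = Bform K q x y + Bform K q x z := by
  simp only [Bform, ← hσ, Pi.add_apply, map_add, mul_add, Finset.sum_add_distrib]

theorem bform_pow (hσ : ∀ x, σ x = x ^ q) (hσσ : ∀ x, σ (σ x) = x) (x y : Fin 3 → K) :
    Bform K q x y ^ q = Bform K q y x := by
  simp only [Bform, ← hσ, map_sum, map_mul, hσσ]
  exact Finset.sum_congr rfl fun i _ => mul_comm _ _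

theorem add_mem_FSpan (hσ : ∀ x, σ x = x ^ q) {β : Fin 3 → Fin 3 → K} {x y : Fin 3 → K}
    (hx : x ∈ FSpan K q β) (hy : y ∈ FSpan K q β) : x + y ∈ FSpan K q β := by
  obtain ⟨c, hc, rfl⟩ := hx
  obtain ⟨d, hd, rfl⟩ := hy
  refine ⟨c + d, fun i => ?_, ?_⟩
  · rw [Pi.add_apply, ← hσ, map_add, hσ, hσ, hc, hd]
  · simp only [Pi.add_apply, add_smul, Finset.sum_add_distrib]

theorem smul_mem_FSpan {β : Fin 3 → Fin 3 → K} {x : Fin 3 → K} {r : K} (hr : r ^ q = r)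
    (hx : x ∈ FSpan K q β) : r • x ∈ FSpan K q β := by
  obtain ⟨c, hc, rfl⟩ := hx
  refine ⟨r • c, fun i => ?_, ?_⟩
  · rw [Pi.smul_apply, smul_eq_mul, mul_pow, hr, hc]
  · simp only [Finset.smul_sum, smul_smul, Pi.smul_apply, smul_eq_mul]

theorem bform_pow_of_mem_FSpan (hσ : ∀ x, σ x = x ^ q) {β : Fin 3 → Fin 3 → K}
    (hβ : ∀ i j, Bform K q (β i) (β j) ^ q = Bform K q (β i) (β j)) {x y : Fin 3 → K}
    (hx : x ∈ FSpan K q β) (hy : y ∈ FSpan K q β) : Bform K q x y ^ q = Bform K q x y := by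
  obtain ⟨c, hc, rfl⟩ := hx
  obtain ⟨d, hd, rfl⟩ := hy
  have key : Bform K q (∑ i, c i • β i) (∑ i, d i • β i)
      = ∑ i, ∑ j, c i * d j * Bform K q (β i) (β j) := by
    simp only [Fin.sum_univ_three, bform_add_left, bform_add_right hσ, bform_smul_smul, hd]
    ring
  rw [key, ← hσ]
  simp only [map_sum, map_mul]
  simp only [hσ, hc, hd, hβ]

/-- A totally isotropic subspace of `K³` has dimension at most one. -/
theorem mul_eq_mul_of_totally_isotropic (hσ : ∀ x, σ x = x ^ q) {u v : Fin 3 → K}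
    (huu : Bform K q u u = 0) (huv : Bform K q u v = 0)
    (hvu : Bform K q v u = 0) (hvv : Bform K q v v = 0) (i j : Fin 3) :
    u i * v j = u j * v i := by
  simp only [Bform, ← hσ, Fin.sum_univ_three] at huu huv hvu hvv
  by_contra hij
  let w : Fin 3 → K := ![σ (u 1) * σ (v 2) - σ (u 2) * σ (v 1),
    σ (u 2) * σ (v 0) - σ (u 0) * σ (v 2), σ (u 0) * σ (v 1) - σ (u 1) * σ (v 0)]
  have hu : ∀ k l, u k * w l = u l * w k := by
    intro k l
    fin_cases k <;> fin_cases l <;> simp [w] <;> grind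
  have hv : ∀ k l, v k * w l = v l * w k := by
    intro k l
    fin_cases k <;> fin_cases l <;> simp [w] <;> grind
  have hw : ∀ k, w k = 0 := by
    intro k
    by_contra hk
    refine hij (mul_right_cancel₀ (mul_ne_zero hk hk) ?_)
    linear_combination (v j * w k) * hu i k - (v i * w k) * hu j k
      + (u k * w i) * hv j k - (u k * w j) * hv i k
  have h0 := hw 0
  have h1 := hw 1
  have h2 := hw 2
  simp only [w, Matrix.cons_val, ← map_mul, ← map_sub, map_eq_zero] at h0 h1 h2
  apply hij
  fin_cases i <;> fin_cases j <;> simp <;> grind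

theorem bform_ne_zero_of_span_ne (hσ : ∀ x, σ x = x ^ q) (hσσ : ∀ x, σ (σ x) = x)
    {u v : Fin 3 → K} (hu : u ≠ 0) (hv : v ≠ 0) (huu : Bform K q u u = 0)
    (hvv : Bform K q v v = 0) (hne : Submodule.span K {u} ≠ Submodule.span K {v}) :
    Bform K q u v ≠ 0 := by
  intro huv
  have hvu : Bform K q v u = 0 := by
    rw [← bform_pow hσ hσσ, huv, ← hσ, map_zero]
  obtain ⟨i, hi⟩ := Function.ne_iff.mp hu
  rw [Pi.zero_apply] at hi
  have hvu' : v = (v i / u i) • u := by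
    ext j
    have := mul_eq_mul_of_totally_isotropic hσ huu huv hvu hvv i j
    simp only [Pi.smul_apply, smul_eq_mul]
    field_simp
    linear_combination this
  have hvi : v i / u i ≠ 0 := fun h => hv (by rw [hvu', h, zero_smul])
  exact hne (by rw [hvu', Submodule.span_singleton_smul_eq hvi.isUnit])

end Frobenius

theorem bform_self_eq_zero_of_span_eq {K : Type} [Field K] {q : ℕ} {u v : Fin 3 → K}
    (h : Submodule.span K {u} = Submodule.span K {v}) (hv : Bform K q v v = 0) :
    Bform K q u u = 0 := by
  obtain ⟨a, rfl⟩ := Submodule.mem_span_singleton.mp (h ▸ Submodule.mem_span_singleton_self u)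
  rw [bform_smul_smul, hv, mul_zero]

/-- **Statement 11.** If `PG(W₁) ∩ PG(W₂)` contains two distinct lines spanned by isotropic
vectors, where each `Wᵢ` is the `F`-span of a triple with `F`-rational invertible Gram
matrix, then it also contains a line spanned by a nonisotropic vector. -/
theorem stmt_11 (p m q : ℕ) (hp : p.Prime) (hpodd : Odd p) (hq : q = p ^ m) (hq7 : 7 ≤ q)
    (K : Type) [Field K] [Fintype K] (hK : Fintype.card K = q ^ 2)
    (β₁ β₂ : Fin 3 → Fin 3 → K)
    (hGramF₁ : ∀ i j, (Bform K q (β₁ i) (β₁ j)) ^ q = Bform K q (β₁ i) (β₁ j))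
    (hGram₁ : (Matrix.of fun i j => Bform K q (β₁ i) (β₁ j)).det ≠ 0)
    (hGramF₂ : ∀ i j, (Bform K q (β₂ i) (β₂ j)) ^ q = Bform K q (β₂ i) (β₂ j))
    (hGram₂ : (Matrix.of fun i j => Bform K q (β₂ i) (β₂ j)).det ≠ 0)
    (L₁ L₂ : Submodule K (Fin 3 → K))
    (hL₁ : L₁ ∈ PGset K (FSpan K q β₁) ∩ PGset K (FSpan K q β₂))
    (hL₂ : L₂ ∈ PGset K (FSpan K q β₁) ∩ PGset K (FSpan K q β₂))
    (hne : L₁ ≠ L₂)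
    (hiso₁ : ∃ v : Fin 3 → K, v ≠ 0 ∧ L₁ = Submodule.span K {v} ∧ Bform K q v v = 0)
    (hiso₂ : ∃ v : Fin 3 → K, v ≠ 0 ∧ L₂ = Submodule.span K {v} ∧ Bform K q v v = 0) :
    ∃ L ∈ PGset K (FSpan K q β₁) ∩ PGset K (FSpan K q β₂),
      ∃ v : Fin 3 → K, v ≠ 0 ∧ L = Submodule.span K {v} ∧ Bform K q v v ≠ 0 := by
  have : Fact p.Prime := ⟨hp⟩
  have : CharP K p := by
    refine charP_of_card_eq_prime_pow (f := m * 2) ?_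
    rw [hK, hq, pow_mul]
  have hσ : ∀ x, iterateFrobenius K p m x = x ^ q := fun x => by
    rw [iterateFrobenius_def, hq]
  have hσσ : ∀ x, iterateFrobenius K p m (iterateFrobenius K p m x) = x := fun x => by
    rw [hσ, hσ, ← pow_mul, ← sq, ← hK, FiniteField.pow_card]
  have htwo : (2 : K) ≠ 0 := by
    refine Ring.two_ne_zero ?_
    rw [ringChar.eq K p]
    rintro rfl
    exact absurd hpodd (by decide)
  obtain ⟨⟨u, huW, hu0, rfl⟩, ⟨u', huW', hu0', hu⟩⟩ := hL₁
  obtain ⟨⟨v, hvW, hv0, rfl⟩, ⟨v', hvW', hv0', hv⟩⟩ := hL₂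
  obtain ⟨x, -, hux, hx⟩ := hiso₁
  obtain ⟨y, -, hvy, hy⟩ := hiso₂
  have huu := bform_self_eq_zero_of_span_eq hux hx
  have hvv := bform_self_eq_zero_of_span_eq hvy hy
  have huv := bform_ne_zero_of_span_ne hσ hσσ hu0 hv0 huu hvv hne
  obtain ⟨a, rfl⟩ := Submodule.mem_span_singleton.mp (hu ▸ Submodule.mem_span_singleton_self u')
  obtain ⟨b, rfl⟩ := Submodule.mem_span_singleton.mp (hv ▸ Submodule.mem_span_singleton_self v')
  have ha : a ≠ 0 := fun h => hu0' (by rw [h, zero_smul])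
  have hb : b ≠ 0 := fun h => hv0' (by rw [h, zero_smul])
  have hs := bform_pow_of_mem_FSpan hσ hGramF₁ huW hvW
  have ht := bform_pow_of_mem_FSpan hσ hGramF₂ huW' hvW'
  have hbb : (b ^ q) ^ q = b := by rw [← hσ, ← hσ, hσσ]
  rw [bform_smul_smul, mul_pow, mul_pow, hs, hbb] at ht
  have hab : (a / b) ^ q = a / b := by
    rw [div_pow, div_eq_div_iff (pow_ne_zero q hb) hb]
    exact mul_right_cancel₀ huv ht
  have hsum : Bform K q (u + v) (u + v) ≠ 0 := by
    rw [bform_add_left, bform_add_right hσ, bform_add_right hσ, huu, hvv,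
      ← bform_pow hσ hσσ u v, hs, zero_add, add_zero, ← two_mul]
    exact mul_ne_zero htwo huv
  have hsum0 : u + v ≠ 0 := by
    intro h
    rw [h, ← zero_smul K (0 : Fin 3 → K), bform_smul_smul, zero_mul, zero_mul] at hsum
    exact hsum rfl
  refine ⟨Submodule.span K {u + v}, ⟨⟨u + v, add_mem_FSpan hσ huW hvW, hsum0, rfl⟩,
    ⟨a • (u + v), ?_, smul_ne_zero ha hsum0, ?_⟩⟩, u + v, hsum0, rfl, hsum⟩
  · have := add_mem_FSpan hσ huW' (smul_mem_FSpan hab hvW')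
    rwa [smul_smul, div_mul_cancel₀ a hb, ← smul_add] at this
  · rw [Submodule.span_singleton_smul_eq ha.isUnit]
end
end

section
/- Let W' be the F-span of vectors β₁, β₂, β₃ ∈ V with B(β_i, β_j) ∈ F for all i, j and (B(β_i, β_j))_{i,j} invertible, write PG(W') = {K·v : v ∈ W', v ≠ 0}, and assume K·e₁ ∉ PG(W'). Then there exists α ∈ K \ F such that, setting y = e₂ + α·e₁, every one-dimensional subspace in {K·τ_y(v) : v ∈ F³, v ≠ 0} ∩ PG(W') is spanned by an isotropic vector (in particular this intersection contains no nonisotropic point). -/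
noncomputable section

lemma exists_eq_imp_eq {F : Type*} [Finite F] (φ : F → F) (t₀ : F) :
    ∃ τ, ∀ t, φ t = τ → t = t₀ := by
  by_cases h : Function.Injective φ
  · exact ⟨φ t₀, fun t ht => h ht⟩
  · have hs : ¬ Function.Surjective φ := fun hs => h (Finite.injective_iff_surjective.2 hs)
    obtain ⟨τ, hτ⟩ := not_forall.1 hs
    exact ⟨τ, fun t ht => absurd ⟨t, ht⟩ hτ⟩

open Polynomial in
lemma exists_isotropic {F : Type*} [Field F] [Fintype F] (h2 : (2 : F) ≠ 0)
    (hF : 4 ≤ Fintype.card F) {A E d : F} (hAE : E ^ 2 ≠ A ^ 2 * d) :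
    ∃ t x : F, x ≠ 0 ∧ x ^ 2 + A * (t ^ 2 + d) + 2 * E * t = 0 := by
  by_cases hA : A = 0
  · subst hA
    have hE : E ≠ 0 := by rintro rfl; simp at hAE
    exact ⟨-1 / (2 * E), 1, one_ne_zero, by field_simp; ring⟩
  suffices h : ∃ u x : F, x ≠ 0 ∧ x ^ 2 + A * (u ^ 2 + (A ^ 2 * d - E ^ 2)) = 0 by
    obtain ⟨u, x, hx, h⟩ := h
    refine ⟨(u - E) / A, x / A, div_ne_zero hx hA, ?_⟩
    field_simp
    linear_combination h
  have hodd : Fintype.card F % 2 = 1 := FiniteField.odd_card_of_char_ne_two fun h => h2 <| by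
    have := ringChar.Nat.cast_ringChar (R := F)
    rw [h] at this
    exact_mod_cast this
  obtain ⟨x₀, u₀, h₀⟩ := FiniteField.exists_root_sum_quadratic (R := F)
    (f := X ^ 2 + C 0 * X + C (A * (A ^ 2 * d - E ^ 2))) (g := C A * X ^ 2)
    (by compute_degree!) (by compute_degree!) hodd
  simp only [eval_add, eval_mul, eval_pow, eval_X, eval_C] at h₀
  by_cases hx₀ : x₀ = 0
  · have hu : u₀ ^ 2 = E ^ 2 - A ^ 2 * d := by
      subst hx₀
      exact mul_left_cancel₀ hA (by linear_combination h₀)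
    have hu0 : u₀ ≠ 0 := by
      rintro rfl
      exact hAE (by linear_combination -hu)
    obtain ⟨n, hn0, hn⟩ : ∃ n : F, n ≠ 0 ∧ -A * n ^ 2 ≠ 1 := by
      by_contra! hcon
      have hp : (X * (C A * X ^ 2 + 1) : F[X]) = 0 := by
        apply eq_zero_of_natDegree_lt_card_of_eval_eq_zero' _ Finset.univ
        · intro n _
          by_cases hn : n = 0
          · simp [hn]
          · simp only [eval_mul, eval_X, eval_add, eval_C, eval_pow, eval_one]
            linear_combination -n * hcon n hn
        · have : (X * (C A * X ^ 2 + 1) : F[X]).natDegree ≤ 3 := by compute_degree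
          rw [Finset.card_univ]
          omega
      have := congrArg (eval 0) ((mul_eq_zero.1 hp).resolve_left X_ne_zero)
      simp at this
    obtain ⟨D, hD⟩ : ∃ D, D = -A * n ^ 2 - 1 := ⟨_, rfl⟩
    have hD0 : D ≠ 0 := hD ▸ sub_ne_zero.2 hn
    refine ⟨u₀ + 2 * u₀ / D, A * n * (2 * u₀) / D,
      div_ne_zero (mul_ne_zero (mul_ne_zero hA hn0) (mul_ne_zero h2 hu0)) hD0, ?_⟩
    rw [show A ^ 2 * d - E ^ 2 = -u₀ ^ 2 by linear_combination hu]
    field_simp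
    linear_combination 4 * A * u₀ ^ 2 * hD
  · exact ⟨u₀, x₀, hx₀, by linear_combination h₀⟩

lemma exists_conic_parameters {F : Type*} [Field F] [Fintype F] (h2 : (2 : F) ≠ 0)
    (hF : 4 ≤ Fintype.card F) {A E d : F} (hd : ¬ IsSquare d) (hAE₀ : A = 0 → E ≠ 0) (r ρ h : F) :
    ∃ s T : F, s ≠ 0 ∧ s ≠ r ∧ ∀ x y z : F, z ≠ 0 →
      -x * z + r * (y ^ 2 - d * z ^ 2) = s * (y ^ 2 - d * z ^ 2) →
      x * (r * y - ρ * z) + h * (y ^ 2 - d * z ^ 2) - E * z ^ 2 - A * z * y =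
        T * (-x * z + r * (y ^ 2 - d * z ^ 2)) + s * (x * y - ρ * (y ^ 2 - d * z ^ 2)) →
      x ^ 2 + A * (y ^ 2 + d * z ^ 2) + 2 * E * y * z = 0 := by
  have hN : ∀ t : F, t ^ 2 - d ≠ 0 := fun t ht => hd ⟨t, by linear_combination -ht⟩
  have hAE : E ^ 2 ≠ A ^ 2 * d := by
    intro hAE
    by_cases hA : A = 0
    · exact hAE₀ hA (by simpa [hA] using hAE)
    · exact hd ⟨E / A, by field_simp; linear_combination -hAE⟩
  obtain ⟨t₀, x₀, hx₀, hiso⟩ := exists_isotropic h2 hF hAE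
  obtain ⟨s, hs, e, he0, hse, he⟩ : ∃ s, s ≠ 0 ∧ ∃ e, e ≠ 0 ∧ s = r - e ∧
      (e * (t₀ ^ 2 - d)) ^ 2 = x₀ ^ 2 := by
    by_cases h : r - x₀ / (t₀ ^ 2 - d) = 0
    · refine ⟨r + x₀ / (t₀ ^ 2 - d), fun h' => ?_, -(x₀ / (t₀ ^ 2 - d)),
        neg_ne_zero.2 (div_ne_zero hx₀ (hN _)), by ring, ?_⟩
      · have : 2 * (x₀ / (t₀ ^ 2 - d)) = 0 := by linear_combination h' - h
        exact mul_ne_zero h2 (div_ne_zero hx₀ (hN _)) this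
      · have := hN t₀
        field_simp
    · refine ⟨_, h, _, div_ne_zero hx₀ (hN _), rfl, ?_⟩
      have := hN t₀
      field_simp
  obtain ⟨T, hT⟩ := exists_eq_imp_eq (fun t : F =>
    (e * (r * t - ρ) + h - (E + A * t) / (t ^ 2 - d) - s * (e * t - ρ)) / s) t₀
  refine ⟨s, T, hs, fun h => he0 (by linear_combination hse - h), fun x y z hz h₁ h₂ => ?_⟩
  obtain ⟨t, rfl⟩ : ∃ t, y = t * z := ⟨y / z, by field_simp⟩
  have hx : x = e * (t ^ 2 - d) * z := by
    apply mul_right_cancel₀ hz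
    rw [hse] at h₁
    linear_combination -h₁
  have ht : t = t₀ := by
    apply hT
    have := hN t
    rw [div_eq_iff hs]
    field_simp
    apply mul_left_cancel₀ (pow_ne_zero 2 hz)
    rw [hx] at h₂
    rw [hse] at h₂ ⊢
    linear_combination h₂
  subst ht
  rw [hx]
  linear_combination z ^ 2 * he + z ^ 2 * hiso

section Involution

variable {K : Type*} [Field K] {σ : K →+* K} {i : K}

lemma exists_re_im (hσ : ∀ x, σ (σ x) = x) (hi : σ i = -i) (hi₀ : i ≠ 0) (h2 : (2 : K) ≠ 0)
    (w : K) : ∃ a b, σ a = a ∧ σ b = b ∧ w = a + b * i := by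
  refine ⟨(w + σ w) / 2, (w - σ w) / (2 * i), ?_, ?_, ?_⟩
  · simp only [map_div₀, map_add, hσ, map_ofNat, add_comm]
  · simp only [map_div₀, map_sub, map_mul, hσ, map_ofNat, hi]
    field_simp
    ring
  · field_simp
    ring

lemma im_eq_im (hi : σ i = -i) (hi₀ : i ≠ 0) (h2 : (2 : K) ≠ 0) {a b c X : K}
    (ha : σ a = a) (hb : σ b = b) (hc : σ c = c) (hX : σ X = X)
    (h : X = a + (b - c) * i) : b = c := by
  rw [h] at hX
  simp only [map_add, map_mul, map_sub, ha, hb, hc, hi] at hX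
  have : 2 * i * (b - c) = 0 := by linear_combination -hX
  exact sub_eq_zero.1 ((mul_eq_zero.1 this).resolve_left (mul_ne_zero h2 hi₀))

lemma exists_reflection_parameter (hσ : ∀ x, σ (σ x) = x) (hi : σ i = -i) (hi₀ : i ≠ 0)
    (h2 : (2 : K) ≠ 0) [Fintype (σ.eqLocusField (RingHom.id K))]
    (hF : 4 ≤ Fintype.card (σ.eqLocusField (RingHom.id K)))
    {a₀ a₁ A E : K} (hA : σ A = A) (hE : σ E = E) (hAE : A = 0 → E ≠ 0) :
    ∃ α : K, σ α ≠ α ∧ ∀ x y z v₀ v₁ v₂ k : K, σ x = x → σ y = y → σ z = z →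
      σ v₀ = v₀ → σ v₁ = v₁ → σ v₂ = v₂ →
      x * a₀ + y * a₁ + z * (E + i * a₁ - i * A) =
        k * (-v₀ + 2 * α * v₁ + 2 * (α * σ α) * v₂) →
      x - σ a₀ * (y + z * i) = k * (v₁ + 2 * σ α * v₂) →
      y + z * i = k * -v₂ →
      x ^ 2 + A * (y ^ 2 + i ^ 2 * z ^ 2) + 2 * E * y * z = 0 := by
  obtain ⟨ρ, r, hρ, hr, rfl⟩ := exists_re_im hσ hi hi₀ h2 a₀
  obtain ⟨g, h, hg, hh, rfl⟩ := exists_re_im hσ hi hi₀ h2 a₁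
  have hd : σ (i ^ 2) = i ^ 2 := by simp [hi]
  have hsq : ¬ IsSquare (⟨i ^ 2, hd⟩ : σ.eqLocusField (RingHom.id K)) := by
    rintro ⟨⟨j, hj⟩, hj'⟩
    have hj : σ j = j := hj
    have hj' : i ^ 2 = j * j := congrArg Subtype.val hj'
    have : (i - j) * (i + j) = 0 := by linear_combination hj'
    have hij : σ i = i := by
      rcases mul_eq_zero.1 this with h | h
      · rw [sub_eq_zero.1 h, hj]
      · rw [eq_neg_of_add_eq_zero_left h, map_neg, hj]
    exact mul_ne_zero h2 hi₀ (by linear_combination hi - hij)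
  obtain ⟨⟨s, hs⟩, ⟨T, hT⟩, hs₀, hsr, H⟩ := exists_conic_parameters
    (F := σ.eqLocusField (RingHom.id K)) (A := ⟨A, hA⟩) (E := ⟨E, hE⟩)
    (fun h => h2 (congrArg Subtype.val h)) hF hsq
    (fun h h' => hAE (congrArg Subtype.val h) (congrArg Subtype.val h'))
    ⟨r, hr⟩ ⟨ρ, hρ⟩ ⟨h, hh⟩
  have hs : σ s = s := hs
  have hT : σ T = T := hT
  have hs₀ : s ≠ 0 := fun h => hs₀ (Subtype.ext h)
  have hsr : s ≠ r := fun h => hsr (Subtype.ext h)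
  simp only [map_add, map_mul, hρ, hr, hi]
  have hσα : σ ((T + s * i) / 2) = (T - s * i) / 2 := by
    simp only [map_div₀, map_add, map_mul, hT, hs, hi, map_ofNat]
    ring
  have hα : 2 * ((T + s * i) / 2) = T + s * i := by field_simp
  have hα' : 2 * ((T - s * i) / 2) = T - s * i := by field_simp
  refine ⟨(T + s * i) / 2, fun h => ?_, ?_⟩
  · rw [hσα] at h
    exact mul_ne_zero (mul_ne_zero h2 hs₀) hi₀ (by linear_combination hα' - hα - 2 * h)
  rw [hσα]
  generalize (T + s * i) / 2 = α at *
  generalize (T - s * i) / 2 = α' at *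
  intro x y z v₀ v₁ v₂ k hx hy hz hv₀ hv₁ hv₂ e₀ e₁ e₂
  have hk : σ (k * σ k) = k * σ k := by rw [map_mul, hσ, mul_comm]
  have e₁' := congrArg σ e₁
  have e₂' := congrArg σ e₂
  simp only [map_add, map_sub, map_neg, map_mul, map_ofNat, hρ, hr, hx, hy, hz, hi, hv₁,
    hv₂] at e₁' e₂'
  have hX : σ (-(k * σ k * v₁ * v₂)) = -(k * σ k * v₁ * v₂) := by
    rw [map_neg, map_mul, map_mul, hk, hv₁, hv₂]
  have key₁ : -x * z + r * (y ^ 2 - i ^ 2 * z ^ 2) = s * (y ^ 2 - i ^ 2 * z ^ 2) := by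
    refine im_eq_im hi hi₀ h2
      (a := x * y - ρ * (y ^ 2 - i ^ 2 * z ^ 2) + T * (y ^ 2 - i ^ 2 * z ^ 2))
      ?_ ?_ ?_ hX ?_
    · simp only [map_add, map_sub, map_mul, map_pow, hx, hy, hz, hρ, hT, hd]
    · simp only [map_add, map_sub, map_neg, map_mul, map_pow, hx, hy, hz, hr, hd]
    · simp only [map_sub, map_mul, map_pow, hy, hz, hs, hd]
    · linear_combination -(y - z * i) * e₁ - 2 * α' * (y - z * i) * e₂ - k * v₁ * e₂' +
        (y + z * i) * (y - z * i) * hα'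
  by_cases hz₀ : z = 0
  · subst hz₀
    by_cases hy₀ : y = 0
    · subst hy₀
      suffices hx₀ : x = 0 by simp [hx₀]
      by_cases hk₀ : k = 0
      · rw [hk₀] at e₁
        linear_combination e₁
      have hv₂₀ : v₂ = 0 := by simpa [hk₀] using e₂
      subst hv₂₀
      have hX' : σ (-(k * σ k * v₀ * v₁)) = -(k * σ k * v₀ * v₁) := by
        rw [map_neg, map_mul, map_mul, hk, hv₀, hv₁]
      have key : x ^ 2 * r = x ^ 2 * s := by
        refine im_eq_im hi hi₀ h2 (a := x ^ 2 * (ρ - T)) ?_ ?_ ?_ hX' ?_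
        · simp only [map_sub, map_mul, map_pow, hx, hρ, hT]
        · simp only [map_mul, map_pow, hx, hr]
        · simp only [map_mul, map_pow, hx, hs]
        · linear_combination -x * e₀ + 2 * α * x * e₁ + k * v₀ * e₁' - x ^ 2 * hα
      by_contra hx₀
      exact hsr (mul_left_cancel₀ (pow_ne_zero 2 hx₀) key).symm
    · exact absurd (mul_right_cancel₀ (pow_ne_zero 2 hy₀) (by linear_combination -key₁)) hsr
  · refine congrArg Subtype.val (H ⟨x, hx⟩ ⟨y, hy⟩ ⟨z, hz⟩ (fun h => hz₀ (congrArg Subtype.val h))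
      (Subtype.ext key₁) (Subtype.ext ?_))
    change x * (r * y - ρ * z) + h * (y ^ 2 - i ^ 2 * z ^ 2) - E * z ^ 2 - A * z * y =
      T * (-x * z + r * (y ^ 2 - i ^ 2 * z ^ 2)) + s * (x * y - ρ * (y ^ 2 - i ^ 2 * z ^ 2))
    have hσα' : σ α' = α := by rw [← hσα, hσ]
    have hX' : σ (k * σ k * v₀ * v₂ + 2 * (α * α') * (y ^ 2 - i ^ 2 * z ^ 2)) =
        k * σ k * v₀ * v₂ + 2 * (α * α') * (y ^ 2 - i ^ 2 * z ^ 2) := by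
      rw [map_add, map_mul, map_mul, hk, hv₀, hv₂]
      simp only [map_sub, map_mul, map_pow, map_ofNat, hσα, hσα', hy, hz, hd, mul_comm α' α]
    refine im_eq_im hi hi₀ h2 (a := x * (ρ * y - r * i ^ 2 * z) + g * (y ^ 2 - i ^ 2 * z ^ 2) +
      E * y * z + A * i ^ 2 * z ^ 2 - T * (x * y - ρ * (y ^ 2 - i ^ 2 * z ^ 2)) -
      s * i ^ 2 * (-x * z + r * (y ^ 2 - i ^ 2 * z ^ 2))) ?_ ?_ ?_ hX' ?_
    · simp only [map_add, map_sub, map_neg, map_mul, map_pow, hx, hy, hz, hρ, hT, hr, hs, hg, hA,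
        hE, hd]
    · simp only [map_add, map_sub, map_mul, map_pow, hx, hy, hz, hr, hρ, hh, hA, hE, hd]
    · simp only [map_add, map_sub, map_neg, map_mul, map_pow, hx, hy, hz, hs, hT, hr, hρ, hd]
    · linear_combination -(y - z * i) * e₀ + 2 * α * (y - z * i) * e₁ + k * v₀ * e₂' +
        2 * α * α' * (y - z * i) * e₂ -
        (x - (ρ + r * -i) * (y + z * i)) * (y - z * i) * hα

end Involution

section Hermitian

variable {K : Type*} [Field K]

/-- The Hermitian form with anti-diagonal Gram matrix attached to a ring endomorphism `σ`. -/
def hermForm (σ : K →+* K) (x y : Fin 3 → K) : K :=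
  x 0 * σ (y 2) + x 1 * σ (y 1) + x 2 * σ (y 0)

variable {σ : K →+* K} {i : K}

lemma hermForm_add_left (x y z : Fin 3 → K) :
    hermForm σ (x + y) z = hermForm σ x z + hermForm σ y z := by
  simp only [hermForm, Pi.add_apply]
  ring

lemma hermForm_smul_left (c : K) (x z : Fin 3 → K) :
    hermForm σ (c • x) z = c * hermForm σ x z := by
  simp only [hermForm, Pi.smul_apply, smul_eq_mul]
  ring

lemma hermForm_sub_left (x y z : Fin 3 → K) :
    hermForm σ (x - y) z = hermForm σ x z - hermForm σ y z := by
  simp only [hermForm, Pi.sub_apply]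
  ring

lemma map_hermForm (hσ : ∀ x, σ (σ x) = x) (x y : Fin 3 → K) :
    σ (hermForm σ x y) = hermForm σ y x := by
  simp only [hermForm, map_add, map_mul, hσ]
  ring

lemma hermForm_add_right (x y z : Fin 3 → K) :
    hermForm σ x (y + z) = hermForm σ x y + hermForm σ x z := by
  simp only [hermForm, Pi.add_apply, map_add]
  ring

lemma hermForm_smul_right (c : K) (x z : Fin 3 → K) :
    hermForm σ x (c • z) = σ c * hermForm σ x z := by
  simp only [hermForm, Pi.smul_apply, smul_eq_mul, map_mul]
  ring

lemma map_coe_eqLocusField (a : σ.eqLocusField (RingHom.id K)) : σ a = a := a.2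

/-- The coordinates of an element of `K` with respect to `1, i`, over the fixed field of `σ`. -/
def reImEquiv (hσ : ∀ x, σ (σ x) = x) (hi : σ i = -i) (hi₀ : i ≠ 0)
    (h2 : (2 : K) ≠ 0) :
    (σ.eqLocusField (RingHom.id K) × σ.eqLocusField (RingHom.id K)) ≃ₗ[
      σ.eqLocusField (RingHom.id K)] K :=
  LinearEquiv.ofBijective
    { toFun := fun w => w.1 + w.2 * i
      map_add' := fun u v => by
        simp only [Prod.fst_add, Prod.snd_add, Subfield.coe_add]
        ring
      map_smul' := fun c v => by
        simp only [Prod.smul_fst, Prod.smul_snd, smul_eq_mul, Subfield.coe_mul, RingHom.id_apply,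
          Subfield.smul_def]
        ring }
    ⟨by
      refine LinearMap.ker_eq_bot.1 (LinearMap.ker_eq_bot'.2 ?_)
      rintro ⟨a, b⟩ h
      have h : (a : K) + b * i = 0 := h
      have hb : (b : K) = 0 := im_eq_im hi hi₀ h2 (a := a) (X := 0) (map_coe_eqLocusField a)
        (map_coe_eqLocusField b) (map_zero σ) (map_zero σ) (by linear_combination -h)
      have ha : (a : K) = 0 := by simpa [hb] using h
      exact Prod.ext (Subtype.ext ha) (Subtype.ext hb),
    fun w => by
      obtain ⟨a, b, ha, hb, rfl⟩ := exists_re_im hσ hi hi₀ h2 w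
      exact ⟨(⟨a, ha⟩, ⟨b, hb⟩), rfl⟩⟩

lemma finrank_eqLocusField (hσ : ∀ x, σ (σ x) = x) (hi : σ i = -i) (hi₀ : i ≠ 0)
    (h2 : (2 : K) ≠ 0) : Module.finrank (σ.eqLocusField (RingHom.id K)) K = 2 := by
  rw [← (reImEquiv hσ hi hi₀ h2).finrank_eq, Module.finrank_prod, Module.finrank_self]

lemma exists_normal_form [Finite K] (hσ : ∀ x, σ (σ x) = x) (hi : σ i = -i) (hi₀ : i ≠ 0)
    (h2 : (2 : K) ≠ 0) {β : Fin 3 → Fin 3 → K}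
    (hGramF : ∀ j k, σ (hermForm σ (β j) (β k)) = hermForm σ (β j) (β k))
    (hGram : (Matrix.of fun j k => hermForm σ (β j) (β k)).det ≠ 0)
    (he₁ : ∀ c : Fin 3 → K, (∀ j, σ (c j) = c j) → (∑ j, c j • β j) 1 = 0 →
      (∑ j, c j • β j) 2 = 0 → ∑ j, c j • β j = 0) :
    ∃ b a₀ a₁ A E : K, b ≠ 0 ∧ σ A = A ∧ σ E = E ∧ (A = 0 → E ≠ 0) ∧
      a₁ + σ a₁ + a₀ * σ a₀ = A ∧
      ∀ c : Fin 3 → K, (∀ j, σ (c j) = c j) → ∃ x y z, σ x = x ∧ σ y = y ∧ σ z = z ∧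
        ∑ j, c j • β j = b • ![x * a₀ + y * a₁ + z * (E + i * a₁ - i * A),
          x - σ a₀ * (y + z * i), y + z * i] := by
  have hrank := finrank_eqLocusField hσ hi hi₀ h2
  set F := σ.eqLocusField (RingHom.id K)
  have hfix : ∀ a : F, σ a = a := map_coe_eqLocusField
  let Ψ : (Fin 3 → F) →ₗ[F] (Fin 3 → K) := Fintype.linearCombination F β
  have hΨ : ∀ c, Ψ c = ∑ j, (c j : K) • β j := fun c => rfl
  have hreal : ∀ c c', σ (hermForm σ (Ψ c) (Ψ c')) = hermForm σ (Ψ c) (Ψ c') := by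
    intro c c'
    simp only [hΨ, Fin.sum_univ_three, hermForm_add_left, hermForm_add_right, hermForm_smul_left,
      hermForm_smul_right, map_add, map_mul, hGramF, hfix]
  have hnd : ∀ c, (∀ j, hermForm σ (Ψ c) (β j) = 0) → c = 0 := by
    intro c hc
    have : (fun j => (c j : K)) = 0 := Matrix.eq_zero_of_vecMul_eq_zero hGram <| by
      ext j
      refine Eq.trans ?_ (hc j)
      simp only [Matrix.vecMul, dotProduct, Matrix.of_apply, hΨ, Fin.sum_univ_three,
        hermForm_add_left, hermForm_smul_left]
    ext j
    exact congrFun this j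
  have hinj : ∀ c, Ψ c = 0 → c = 0 := fun c hc => hnd c fun j => by simp [hc, hermForm]
  have he : ∀ c, Ψ c 1 = 0 → Ψ c 2 = 0 → Ψ c = 0 := fun c =>
    he₁ (fun j => c j) (fun j => hfix (c j))
  -- the point `P` of `W'` on the line `e₁ᗮ`
  obtain ⟨p, hp, hp₀⟩ : ∃ p, Ψ p 2 = 0 ∧ p ≠ 0 := by
    have := LinearMap.ker_ne_bot_of_finrank_lt (f := (LinearMap.proj 2).comp Ψ) (by
      rw [hrank, Module.finrank_fin_fun]; norm_num)
    exact (Submodule.ne_bot_iff _).1 this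
  have hb : Ψ p 1 ≠ 0 := fun h => hp₀ (hinj p (he p h hp))
  -- the coordinates `(B(w, P), w₂)` identify `W'` with `F × K`
  let S : (Fin 3 → F) →ₗ[F] F × K :=
    { toFun := fun c => (⟨hermForm σ (Ψ c) (Ψ p), hreal c p⟩, Ψ c 2)
      map_add' := fun c c' => Prod.ext
        (Subtype.ext (by simp only [map_add, hermForm_add_left]; rfl)) (by simp)
      map_smul' := fun a c => Prod.ext
        (Subtype.ext ((congrArg (hermForm σ · _) (map_smul Ψ a c)).trans
          (hermForm_smul_left _ _ _))) (by simp) }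
  have hSinj : ∀ c, hermForm σ (Ψ c) (Ψ p) = 0 → Ψ c 2 = 0 → c = 0 := by
    intro c h₁ h₂
    refine hinj c (he c ?_ h₂)
    simpa [hermForm, hp, h₂, hb] using h₁
  have hS : Function.Surjective S := by
    rw [← LinearMap.injective_iff_surjective_of_finrank_eq_finrank
      (by rw [Module.finrank_prod, hrank, Module.finrank_fin_fun, Module.finrank_self]),
      ← LinearMap.ker_eq_bot, LinearMap.ker_eq_bot']
    exact fun c hc => hSinj c (congrArg (Subtype.val ∘ Prod.fst) hc) (congrArg Prod.snd hc)
  obtain ⟨u, hu⟩ := hS (0, Ψ p 1)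
  obtain ⟨v, hv⟩ := hS (0, Ψ p 1 * i)
  have hu₁ : hermForm σ (Ψ u) (Ψ p) = 0 := congrArg (Subtype.val ∘ Prod.fst) hu
  have hu₂ : Ψ u 2 = Ψ p 1 := congrArg Prod.snd hu
  have hv₁ : hermForm σ (Ψ v) (Ψ p) = 0 := congrArg (Subtype.val ∘ Prod.fst) hv
  have hv₂ : Ψ v 2 = Ψ p 1 * i := congrArg Prod.snd hv
  have huu := hreal u u
  have huv := hreal u v
  have hpp := hreal p p
  have hcomb : ∀ x y z : F, Ψ (x • p + y • u + z • v) =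
      (x : K) • Ψ p + (y : K) • Ψ u + (z : K) • Ψ v := by
    intro x y z
    simp only [map_add, map_smul]
    rfl
  have hdec : ∀ c, ∃ x y z : F, c = x • p + y • u + z • v := by
    intro c
    obtain ⟨y, z, hy, hz, hyz⟩ := exists_re_im hσ hi hi₀ h2 (Ψ c 2 / Ψ p 1)
    have hcp := hreal c p
    have hpp₀ : hermForm σ (Ψ p) (Ψ p) ≠ 0 := by
      simp [hermForm, hp, hb]
    refine ⟨⟨hermForm σ (Ψ c) (Ψ p) / hermForm σ (Ψ p) (Ψ p), ?_⟩, ⟨y, hy⟩, ⟨z, hz⟩, ?_⟩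
    · change σ _ = _
      rw [map_div₀, hcp, hpp]
      rfl
    · rw [div_eq_iff hb] at hyz
      refine sub_eq_zero.1 (hSinj _ ?_ ?_)
      · rw [map_sub, hcomb]
        simp only [hermForm_sub_left, hermForm_add_left, hermForm_smul_left, hu₁, hv₁]
        field_simp
        ring
      · rw [map_sub, hcomb]
        simp only [Pi.sub_apply, Pi.add_apply, Pi.smul_apply, smul_eq_mul, hp, hu₂, hv₂]
        linear_combination hyz
  have hN : Ψ p 1 * σ (Ψ p 1) ≠ 0 := by simp [hb]
  have hσb : σ (Ψ p 1) ≠ 0 := by simp [hb]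
  have hu' : Ψ u 1 * σ (Ψ p 1) = -(Ψ p 1 * σ (Ψ p 0)) := by
    simp only [hermForm, hp, hu₂, map_zero] at hu₁
    linear_combination hu₁
  refine ⟨Ψ p 1, Ψ p 0 / Ψ p 1, Ψ u 0 / Ψ p 1,
    hermForm σ (Ψ u) (Ψ u) / (Ψ p 1 * σ (Ψ p 1)),
    hermForm σ (Ψ u) (Ψ v) / (Ψ p 1 * σ (Ψ p 1)), hb, ?_, ?_, ?_, ?_, ?_⟩
  · rw [map_div₀, huu, map_mul, hσ, mul_comm (σ _)]
  · rw [map_div₀, huv, map_mul, hσ, mul_comm (σ _)]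
  · intro hA hE
    have hA := (div_eq_zero_iff.1 hA).resolve_right hN
    have hE := (div_eq_zero_iff.1 hE).resolve_right hN
    have hu₀ : u = 0 := hnd u fun j => by
      obtain ⟨x, y, z, h⟩ := hdec (Pi.single j 1)
      have hj : Ψ (Pi.single j 1) = β j := by simp [Ψ]
      rw [← hj, h, hcomb]
      simp only [hermForm_add_right, hermForm_smul_right, hu₁, hA, hE, mul_zero, add_zero]
    exact hb (by rw [← hu₂, hu₀, map_zero, Pi.zero_apply])
  · have hu'' := congrArg σ hu'
    simp only [map_mul, map_neg, hσ] at hu''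
    have h₁ : Ψ u 1 * σ (Ψ u 1) = Ψ p 0 * σ (Ψ p 0) := by
      apply mul_right_cancel₀ hN
      linear_combination σ (Ψ u 1) * Ψ p 1 * hu' - Ψ p 1 * σ (Ψ p 0) * hu''
    simp only [hermForm, hu₂, h₁, map_div₀]
    field_simp
    ring
  · intro c hc
    obtain ⟨x, y, z, h⟩ := hdec fun j => ⟨c j, hc j⟩
    refine ⟨x, y, z, hfix x, hfix y, hfix z, ?_⟩
    have hc' : ∑ j, c j • β j = (x : K) • Ψ p + (y : K) • Ψ u + (z : K) • Ψ v := by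
      rw [← hcomb, ← h]
      rfl
    rw [hc']
    have hv' : Ψ v 1 = i * Ψ u 1 := by
      apply mul_right_cancel₀ hσb
      simp only [hermForm, hp, hv₂, map_zero] at hv₁
      linear_combination hv₁ - i * hu'
    have hv'' : Ψ v 0 * σ (Ψ p 1) = hermForm σ (Ψ u) (Ψ v) -
        i * (hermForm σ (Ψ u) (Ψ u) - Ψ u 0 * σ (Ψ p 1)) := by
      rw [← huv, map_hermForm hσ]
      simp only [hermForm, hu₂, hv₂, hv']
      ring
    ext j
    fin_cases j
    · simp only [Fin.zero_eta, Pi.add_apply, Pi.smul_apply, smul_eq_mul, Matrix.cons_val_zero]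
      field_simp
      linear_combination z * hv''
    · simp only [Fin.mk_one, Pi.add_apply, Pi.smul_apply, smul_eq_mul, Matrix.cons_val_one,
        Matrix.cons_val_zero, hv', map_div₀]
      field_simp
      linear_combination (y + z * i) * hu'
    · simp only [Fin.reduceFinMk, Pi.add_apply, Pi.smul_apply, smul_eq_mul, Matrix.cons_val, hp,
        hu₂, hv₂]
      ring

end Hermitian

lemma tauReflA_eq {K : Type} [Field K] {q : ℕ} (hq : q ≠ 0) (α : K) (v : Fin 3 → K) :
    tauReflA K q ![α, 1, 0] v = ![-v 0 + 2 * α * v 1 + 2 * (α * α ^ q) * v 2,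
      v 1 + 2 * α ^ q * v 2, -v 2] := by
  ext j
  fin_cases j <;>
  · simp [tauReflA, BformA, hq]
    try ring

lemma exists_pow_ne {K : Type*} [Field K] [Fintype K] {q : ℕ} (hq : 1 < q)
    (hK : Fintype.card K = q ^ 2) : ∃ w : K, w ^ q ≠ w := by
  by_contra! h
  refine FiniteField.X_pow_card_sub_X_ne_zero K hq
    (Polynomial.eq_zero_of_natDegree_lt_card_of_eval_eq_zero' _ Finset.univ (fun w _ => ?_) ?_)
  · simp [h w]
  · rw [FiniteField.X_pow_card_sub_X_natDegree_eq K hq, Finset.card_univ, hK]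
    nlinarith

/-- **Statement 12.** Let `W'` be the `F`-span of a triple with `F`-rational invertible Gram
matrix and `K·e₁ ∉ PG(W')`.  Then there is `α ∈ K \ F` such that, with `y = e₂ + α·e₁`,
every line of `τ_y(w₀) ∩ PG(W')` is spanned by an isotropic vector. -/
theorem stmt_12 (p m q : ℕ) (hp : p.Prime) (hpodd : Odd p) (hq : q = p ^ m) (hq7 : 7 ≤ q)
    (K : Type) [Field K] [Fintype K] (hK : Fintype.card K = q ^ 2)
    (β : Fin 3 → Fin 3 → K)
    (hGramF : ∀ i j, (BformA K q (β i) (β j)) ^ q = BformA K q (β i) (β j))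
    (hGram : (Matrix.of fun i j => BformA K q (β i) (β j)).det ≠ 0)
    (he₁ : Submodule.span K {![(1 : K), 0, 0]} ∉ PGset K (FSpan K q β)) :
    ∃ α : K, α ^ q ≠ α ∧
      ∀ L ∈ tauPlane K q ![α, 1, 0] ∩ PGset K (FSpan K q β),
        ∀ v ∈ L, BformA K q v v = 0 := by
  have hq0 : q ≠ 0 := by omega
  have hm : m ≠ 0 := by
    rintro rfl
    simp at hq
    omega
  have : Fact p.Prime := ⟨hp⟩
  have hcard : Fintype.card K = p ^ (m * 2) := by rw [hK, hq, pow_mul]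
  have : CharP K p := charP_of_card_eq_prime_pow hcard
  obtain ⟨σ, hσq⟩ : ∃ σ : K →+* K, ∀ x, x ^ q = σ x :=
    ⟨iterateFrobenius K p m, fun x => by rw [iterateFrobenius_def, hq]⟩
  have hσ : ∀ x, σ (σ x) = x := fun x => by
    rw [← hσq, ← hσq, ← pow_mul, ← pow_two, ← hK, FiniteField.pow_card]
  have h2 : (2 : K) ≠ 0 := by
    intro h
    have := (CharP.cast_eq_zero_iff K p 2).1 (by exact_mod_cast h)
    rw [Nat.prime_dvd_prime_iff_eq hp Nat.prime_two] at this
    rw [this] at hpodd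
    exact absurd hpodd (by decide)
  obtain ⟨w, hw⟩ := exists_pow_ne (by omega) hK
  obtain ⟨i, hi, hi₀⟩ : ∃ i, σ i = -i ∧ i ≠ 0 :=
    ⟨w - σ w, by simp [hσ], sub_ne_zero.2 fun h => hw ((hσq w).trans h.symm)⟩
  have hB : ∀ x y, BformA K q x y = hermForm σ x y := fun x y => by
    simp only [BformA, hermForm, hσq]
  let _ := Fintype.ofFinite (σ.eqLocusField (RingHom.id K))
  have hF : 4 ≤ Fintype.card (σ.eqLocusField (RingHom.id K)) := by
    have := Fintype.card_congr (reImEquiv hσ hi hi₀ h2).toEquiv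
    rw [Fintype.card_prod, hK] at this
    nlinarith
  simp only [hB, hσq] at hGramF hGram ⊢
  obtain ⟨b, a₀, a₁, A, E, hb, hA, hE, hAE, ha, hW⟩ := exists_normal_form hσ hi hi₀ h2 hGramF hGram
    fun c hc h₁ h₂ => by
      by_contra hne
      refine he₁ ⟨_, ⟨c, fun j => (hσq _).trans (hc j), rfl⟩, hne, ?_⟩
      have h₀ : (∑ j, c j • β j) 0 ≠ 0 := fun h₀ => hne <| by
        ext j
        fin_cases j
        exacts [h₀, h₁, h₂]
      rw [← Submodule.span_singleton_smul_eq (IsUnit.mk0 _ h₀)]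
      congr 2
      ext j
      fin_cases j
      · simp
      · simpa using h₁.symm
      · simpa using h₂.symm
  obtain ⟨α, hα, H⟩ := exists_reflection_parameter hσ hi hi₀ h2 hF (a₀ := a₀) (a₁ := a₁) hA hE hAE
  refine ⟨α, hα, ?_⟩
  rintro _ ⟨⟨v, -, hv, rfl⟩, ⟨_, ⟨c, hc, rfl⟩, -, hL⟩⟩ u hu
  simp only [hσq] at hc hv
  obtain ⟨x, y, z, hx, hy, hz, hxyz⟩ := hW c hc
  have hmem : ∑ j, c j • β j ∈ Submodule.span K {tauReflA K q ![α, 1, 0] v} :=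
    hL ▸ Submodule.mem_span_singleton_self _
  obtain ⟨k, hk⟩ := Submodule.mem_span_singleton.1 hmem
  rw [hL] at hu
  obtain ⟨l, rfl⟩ := Submodule.mem_span_singleton.1 hu
  rw [tauReflA_eq hq0, hσq, hxyz] at hk
  have hk₀ := congrFun hk 0
  have hk₁ := congrFun hk 1
  have hk₂ := congrFun hk 2
  simp only [Pi.smul_apply, smul_eq_mul, Matrix.cons_val] at hk₀ hk₁ hk₂
  have hQ := H x y z (v 0) (v 1) (v 2) (k / b) hx hy hz (hv 0) (hv 1) (hv 2)
    (by field_simp; linear_combination -hk₀) (by field_simp; linear_combination -hk₁)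
    (by field_simp; linear_combination -hk₂)
  rw [hxyz]
  simp only [hermForm, Pi.smul_apply, smul_eq_mul, Matrix.cons_val, map_mul, map_add, map_sub, hx,
    hy, hz, hA, hE, hi, hσ]
  linear_combination l * σ l * b * σ b * (hQ + (y ^ 2 - i ^ 2 * z ^ 2) * ha)
end
end
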